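/- Let f be Lipschitz continuous on [−1,1] with Lipschitz constant K. Then the sequence of polynomials p_n interpolating f at the n+1 Chebyshev points cos(jπ/n) converges uniformly to f on [−1,1] as n → ∞. -/

import Mathlib

open Real Polynomial

/-- Discrete orthogonality of the sines `sin (k φ)`, `1 ≤ k ≤ n`, at the midpoints
`φ = (2 j + 1) π / (2 n)`. -/
lemma sum_sin_mul_sin_midpoints {n k l : ℕ} (hk : k ∈ Finset.Icc 1 n) (hl : l ∈ Finset.Icc 1 n) :
    ∑ j ∈ Finset.range n, sin (k * ((2 * j + 1) / (2 * n) * π)) *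
      sin (l * ((2 * j + 1) / (2 * n) * π)) =
    if k = l then (if k = n then (n : ℝ) else n / 2) else 0 := by
  rw [Finset.mem_Icc] at hk hl
  have hn : n ≠ 0 := by omega
  have hsum : ∀ m : ℤ, ¬ (2 * n : ℤ) ∣ m →
      ∑ j ∈ Finset.range n, cos (m * ((2 * j + 1) / (2 * n) * π)) = 0 := by
    intro m hm
    have h := Chebyshev.sumZeroes_T_of_not_dvd hm
    simp only [Chebyshev.sumZeroes, Chebyshev.T_real_cos] at h
    exact (mul_eq_zero.mp h).resolve_left (by positivity)
  have hprod : ∀ x : ℝ, sin (k * x) * sin (l * x) =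
      (cos (((k - l : ℤ) : ℝ) * x) - cos (((k + l : ℤ) : ℝ) * x)) / 2 := by
    intro x
    push_cast
    rw [sub_mul, add_mul, cos_sub, cos_add]
    ring
  simp_rw [hprod, ← Finset.sum_div, Finset.sum_sub_distrib]
  by_cases hkl : k = l
  · subst hkl
    by_cases hkn : k = n
    · subst hkn
      have hcos : ∀ j : ℕ, cos (((k + k : ℤ) : ℝ) * ((2 * j + 1) / (2 * k) * π)) = -1 := by
        intro j
        rw [show ((k + k : ℤ) : ℝ) * ((2 * j + 1) / (2 * k) * π) = j * (2 * π) + π by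
          push_cast; field_simp; ring]
        exact cos_nat_mul_two_pi_add_pi j
      simp only [hcos]
      simp
    · have h2 : ¬ (2 * n : ℤ) ∣ (k + k : ℤ) := by
        intro h
        have := Int.le_of_dvd (by omega) h
        omega
      rw [hsum _ h2]
      simp [hkn]
  · have h1 : ¬ (2 * n : ℤ) ∣ (k - l : ℤ) := by
      intro h
      have := Int.eq_zero_of_abs_lt_dvd h (by rw [abs_lt]; omega)
      omega
    have h2 : ¬ (2 * n : ℤ) ∣ (k + l : ℤ) := by
      intro h
      have := Int.le_of_dvd (by omega) h
      omega
    rw [hsum _ h1, hsum _ h2]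
    simp [hkl]

/-- A discrete Bessel inequality for sine sums sampled at the midpoints. -/
lemma sum_sq_le_sum_sq_sine_sum (n : ℕ) (b : ℕ → ℝ) :
    n / 2 * ∑ k ∈ Finset.Icc 1 n, b k ^ 2 ≤
      ∑ j ∈ Finset.range n,
        (∑ k ∈ Finset.Icc 1 n, b k * sin (k * ((2 * j + 1) / (2 * n) * π))) ^ 2 := by
  have h : ∑ j ∈ Finset.range n,
        (∑ k ∈ Finset.Icc 1 n, b k * sin (k * ((2 * j + 1) / (2 * n) * π))) ^ 2 =
      ∑ k ∈ Finset.Icc 1 n, ∑ l ∈ Finset.Icc 1 n, b k * b l *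
        ∑ j ∈ Finset.range n, sin (k * ((2 * j + 1) / (2 * n) * π)) *
          sin (l * ((2 * j + 1) / (2 * n) * π)) := by
    simp_rw [sq, Finset.sum_mul_sum, Finset.mul_sum]
    rw [Finset.sum_comm]
    refine Finset.sum_congr rfl fun k _ ↦ ?_
    rw [Finset.sum_comm]
    exact Finset.sum_congr rfl fun l _ ↦ Finset.sum_congr rfl fun j _ ↦ by ring
  rw [h, Finset.mul_sum]
  refine Finset.sum_le_sum fun k hk ↦ ?_
  rw [Finset.sum_congr rfl fun l hl ↦ by rw [sum_sin_mul_sin_midpoints hk hl]]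
  simp only [mul_ite, mul_zero, Finset.sum_ite_eq, hk, if_true]
  have : (0 : ℝ) ≤ n := n.cast_nonneg
  split_ifs <;> nlinarith [sq_nonneg (b k)]

/-- A polynomial of degree at most `n` is a cosine polynomial of degree at most `n` in `θ` after
the substitution `x = cos θ`. -/
lemma exists_eval_cos_eq_cosine_sum {n : ℕ} {q : ℝ[X]} (hq : q.degree ≤ n) :
    ∃ (c : ℝ) (a : ℕ → ℝ), ∀ θ : ℝ,
      q.eval (cos θ) = c + ∑ k ∈ Finset.Icc 1 n, a k * cos (k * θ) := by
  have hmem : q ∈ degreeLE ℝ n := mem_degreeLE.mpr hq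
  rw [← Sequence.span_degreeLE (Chebyshev.chebyshevTsequence ℝ) (by simp),
    show Set.Iic n = Finset.Icc 0 n by ext; simp,
    Submodule.mem_span_image_finset_iff_exists_fun'] at hmem
  obtain ⟨a, rfl⟩ := hmem
  refine ⟨a 0, a, fun θ ↦ ?_⟩
  rw [eval_finsetSum, ← Finset.add_sum_Ioc_eq_sum_Icc n.zero_le]
  simp [Chebyshev.chebyshevTsequence, Chebyshev.T_real_cos, ← Finset.Icc_add_one_left_eq_Ioc]

/-- If the values of a cosine polynomial at consecutive points `j π / n` differ by at most `δ`,
then its coefficients satisfy a discrete Sobolev bound. -/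
lemma sum_sq_mul_coeff_le {n : ℕ} (hn : n ≠ 0) {δ : ℝ} {a : ℕ → ℝ}
    (h : ∀ j < n, |∑ k ∈ Finset.Icc 1 n, a k * (cos (k * (j * π / n)) -
      cos (k * ((j + 1 : ℕ) * π / n)))| ≤ δ) :
    ∑ k ∈ Finset.Icc 1 n, (k * a k) ^ 2 ≤ n ^ 2 * δ ^ 2 / 2 := by
  have hn0 : (0 : ℝ) < n := by positivity
  have hdiff : ∀ j : ℕ, ∑ k ∈ Finset.Icc 1 n, a k * (cos (k * (j * π / n)) -
      cos (k * ((j + 1 : ℕ) * π / n))) = ∑ k ∈ Finset.Icc 1 n,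
        (2 * a k * sin (k * π / (2 * n))) * sin (k * ((2 * j + 1) / (2 * n) * π)) := by
    intro j
    refine Finset.sum_congr rfl fun k _ ↦ ?_
    rw [show (k : ℝ) * (j * π / n) = k * ((2 * j + 1) / (2 * n) * π) - k * π / (2 * n) by
        field_simp; ring,
      show (k : ℝ) * ((j + 1 : ℕ) * π / n) =
        k * ((2 * j + 1) / (2 * n) * π) + k * π / (2 * n) by push_cast; field_simp; ring,
      cos_sub, cos_add]
    ring
  have hupper : ∑ j ∈ Finset.range n, (∑ k ∈ Finset.Icc 1 n,
      (2 * a k * sin (k * π / (2 * n))) * sin (k * ((2 * j + 1) / (2 * n) * π))) ^ 2 ≤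
        n * δ ^ 2 := by
    refine (Finset.sum_le_card_nsmul _ _ (δ ^ 2) fun j hj ↦ ?_).trans (by simp)
    rw [← hdiff]
    exact sq_le_sq' (abs_le.mp (h j (Finset.mem_range.mp hj))).1
      (abs_le.mp (h j (Finset.mem_range.mp hj))).2
  have hlower : 4 / n ^ 2 * ∑ k ∈ Finset.Icc 1 n, (k * a k) ^ 2 ≤
      ∑ k ∈ Finset.Icc 1 n, (2 * a k * sin (k * π / (2 * n))) ^ 2 := by
    rw [Finset.mul_sum]
    refine Finset.sum_le_sum fun k hk ↦ ?_
    have hkn : (k : ℝ) ≤ n := by exact_mod_cast (Finset.mem_Icc.mp hk).2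
    have hsin : (k : ℝ) / n ≤ sin (k * π / (2 * n)) := by
      have := mul_le_sin (x := k * π / (2 * n)) (by positivity) (by
        rw [div_le_div_iff₀ (by positivity) two_pos]
        nlinarith [pi_pos])
      convert this using 1
      field_simp
    calc 4 / (n : ℝ) ^ 2 * (k * a k) ^ 2 = (2 * a k) ^ 2 * (k / n) ^ 2 := by field_simp; ring
      _ ≤ (2 * a k) ^ 2 * sin (k * π / (2 * n)) ^ 2 := by gcongr
      _ = _ := by ring
  have hbessel := (sum_sq_le_sum_sq_sine_sum n _).trans hupper
  have := (mul_le_mul_of_nonneg_left hlower (by positivity : (0 : ℝ) ≤ n / 2)).trans hbessel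
  rw [show (n : ℝ) / 2 * (4 / n ^ 2 * ∑ k ∈ Finset.Icc 1 n, (k * a k) ^ 2) =
    2 * (∑ k ∈ Finset.Icc 1 n, (k * a k) ^ 2) / n by field_simp; ring,
    div_le_iff₀ hn0] at this
  linarith

/-- A cosine polynomial of degree `n` varies little over distance `d`, in terms of a Sobolev bound
on its coefficients. -/
lemma cosine_sum_sub_sq_le {n : ℕ} {a : ℕ → ℝ} (θ φ : ℝ) :
    (∑ k ∈ Finset.Icc 1 n, a k * (cos (k * θ) - cos (k * φ))) ^ 2 ≤
      n * (θ - φ) ^ 2 * ∑ k ∈ Finset.Icc 1 n, (k * a k) ^ 2 := by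
  refine sq_sum_le_card_mul_sum_sq.trans ?_
  rw [Nat.card_Icc, Nat.add_sub_cancel, mul_assoc]
  refine mul_le_mul_of_nonneg_left ?_ n.cast_nonneg
  rw [Finset.mul_sum]
  refine Finset.sum_le_sum fun k _ ↦ ?_
  have h : (cos (k * θ) - cos (k * φ)) ^ 2 ≤ (k * θ - k * φ) ^ 2 :=
    sq_le_sq.mpr (abs_cos_sub_cos_le _ _)
  calc (a k * (cos (k * θ) - cos (k * φ))) ^ 2
      = a k ^ 2 * (cos (k * θ) - cos (k * φ)) ^ 2 := by ring
    _ ≤ a k ^ 2 * (k * θ - k * φ) ^ 2 := by gcongr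
    _ = _ := by ring

/-- Error bound for interpolation of a Lipschitz function at the Chebyshev points
`cos (j π / n)`. -/
lemma abs_sub_chebyshev_interpolant_le {f : ℝ → ℝ} {K : NNReal}
    (hf : LipschitzOnWith K f (Set.Icc (-1 : ℝ) 1)) {n : ℕ} (hn : n ≠ 0) {q : ℝ[X]}
    (hq : q.degree ≤ n) (hqf : ∀ j ≤ n, q.eval (cos (j * π / n)) = f (cos (j * π / n)))
    {x : ℝ} (hx : x ∈ Set.Icc (-1 : ℝ) 1) :
    |f x - q.eval x| ≤ K * π / n + K * π ^ 2 / √n := by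
  have hn0 : (0 : ℝ) < n := by positivity
  have hlip : ∀ s t : ℝ, |f (cos s) - f (cos t)| ≤ K * |s - t| := fun s t ↦
    (hf.dist_le_mul _ (cos_mem_Icc s) _ (cos_mem_Icc t)).trans
      (mul_le_mul_of_nonneg_left (abs_cos_sub_cos_le s t) K.coe_nonneg)
  obtain ⟨c, a, ha⟩ := exists_eval_cos_eq_cosine_sum hq
  have hsub : ∀ s t : ℝ, q.eval (cos s) - q.eval (cos t) =
      ∑ k ∈ Finset.Icc 1 n, a k * (cos (k * s) - cos (k * t)) := by
    intro s t
    simp only [ha, mul_sub, Finset.sum_sub_distrib]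
    ring
  have hcoeff := sum_sq_mul_coeff_le (a := a) (δ := K * (π / n)) hn fun j hj ↦ by
    rw [← hsub, hqf j hj.le, hqf (j + 1) hj]
    refine (hlip _ _).trans_eq ?_
    rw [show (j : ℝ) * π / n - (j + 1 : ℕ) * π / n = -(π / n) by push_cast; ring, abs_neg,
      abs_of_pos (by positivity)]
  set θ := arccos x
  have hxθ : cos θ = x := cos_arccos hx.1 hx.2
  set j := ⌊θ * n / π⌋₊
  have hθ0 : 0 ≤ θ := arccos_nonneg x
  have hle : θ * n / π ≤ n := by
    rw [div_le_iff₀ pi_pos, mul_comm]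
    exact mul_le_mul_of_nonneg_left (arccos_le_pi x) hn0.le
  have hjn : j ≤ n := Nat.floor_le_of_le hle
  have hdist : |θ - j * π / n| ≤ π / n := by
    have h1 : (j : ℝ) ≤ θ * n / π := Nat.floor_le (by positivity)
    have h2 : θ * n / π < j + 1 := Nat.lt_floor_add_one _
    rw [le_div_iff₀ pi_pos] at h1
    rw [div_lt_iff₀ pi_pos] at h2
    have h3 : θ - j * π / n = (θ * n - j * π) / n := by field_simp
    rw [h3, abs_of_nonneg (div_nonneg (by linarith) hn0.le)]
    gcongr
    linarith
  have hfx : |f (cos θ) - f (cos (j * π / n))| ≤ K * π / n :=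
    (hlip _ _).trans ((mul_le_mul_of_nonneg_left hdist K.coe_nonneg).trans_eq (by ring))
  have hqx : |q.eval (cos (j * π / n)) - q.eval (cos θ)| ≤ K * π ^ 2 / √n := by
    rw [abs_sub_comm, hsub]
    refine abs_le_of_sq_le_sq ?_ (by positivity)
    calc _ ≤ n * (θ - j * π / n) ^ 2 * ∑ k ∈ Finset.Icc 1 n, (k * a k) ^ 2 :=
          cosine_sum_sub_sq_le _ _
      _ ≤ n * (π / n) ^ 2 * (n ^ 2 * (K * (π / n)) ^ 2) := by
          rw [← sq_abs (θ - _)]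
          gcongr
          refine hcoeff.trans (half_le_self (by positivity))
      _ = (K * π ^ 2 / √n) ^ 2 := by
          rw [div_pow _ (√n), sq_sqrt hn0.le]
          field_simp
  rw [← hxθ]
  calc |f (cos θ) - q.eval (cos θ)|
      = |(f (cos θ) - f (cos (j * π / n))) + (q.eval (cos (j * π / n)) - q.eval (cos θ))| := by
        rw [hqf j hjn]; ring_nf
    _ ≤ _ := (abs_add_le _ _).trans (add_le_add hfx hqx)

theorem chebyshev_interpolants_converge_uniformly_of_lipschitz
    (f : ℝ → ℝ) (K : NNReal)
    (hf : LipschitzOnWith K f (Set.Icc (-1 : ℝ) 1))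
    (p : ℕ → Polynomial ℝ)
    (hp : ∀ n, 1 ≤ n → (p n).degree ≤ n ∧
      ∀ j ≤ n, (p n).eval (Real.cos (j * Real.pi / n)) = f (Real.cos (j * Real.pi / n))) :
    ∀ ε > 0, ∃ N : ℕ, ∀ n ≥ N, ∀ x ∈ Set.Icc (-1 : ℝ) 1,
      |f x - (p n).eval x| < ε := by
  intro ε hε
  have hn : Filter.Tendsto (fun n : ℕ ↦ (n : ℝ)) Filter.atTop Filter.atTop :=
    tendsto_natCast_atTop_atTop
  have hlim : Filter.Tendsto (fun n : ℕ ↦ K * π / n + K * π ^ 2 / √n) Filter.atTop (nhds 0) := by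
    simpa using (hn.const_div_atTop (K * π)).add
      ((tendsto_sqrt_atTop.comp hn).const_div_atTop (K * π ^ 2))
  obtain ⟨N, hN⟩ := Filter.eventually_atTop.mp
    ((hlim.eventually_lt_const hε).and (Filter.eventually_ge_atTop 1))
  refine ⟨N, fun n hnN x hx ↦ ?_⟩
  obtain ⟨hlt, hn1⟩ := hN n hnN
  exact (abs_sub_chebyshev_interpolant_le hf (by omega) (hp n hn1).1 (hp n hn1).2 hx).trans_lt hlt
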